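/- arXiv:1604.01925 — 2 statements merged into one kernel-verified Lean document; each statement's English description precedes it below -/
import Mathlib

section
/- Let q be a prime power, m a positive integer, and σ, δ ∈ (0,1) reals with δ < (1−2σ)/2. Let d be a positive integer with d ≤ σ(q−1) − 1. Then the Reed-Muller code RM(q,d,m) is a (q−1, δ, ε)-locally correctable code, where ε = 4(δ−δ²)/((1−2σ−2δ)²(q−1)). -/
open scoped BigOperators

/-- `C ⊆ F^I` is a `(k; r, δ, ε)`-locally correctable code: for every `S ⊆ I` with
`|S| ≤ k` there is a (finitely supported) probability distribution over pairs `(T, g)`,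
`T ⊆ I` with `|T| ≤ r` and `g : (T → F) → (S → F)`, such that for every codeword `c ∈ C`
and every `y` within relative Hamming distance `δ` of `c`, the probability that
`g (y|_T) = c|_S` is at least `1 - ε`. -/
def LocallyCorrectable {F I : Type*} [Fintype F] [DecidableEq F] [Fintype I]
    (C : Set (I → F)) (k r : ℕ) (δ ε : ℝ) : Prop :=
  ∀ S : Finset I, S.card ≤ k →
    ∃ D : PMF ((T : Finset I) × ((↥T → F) → (↥S → F))),
      (∀ p ∈ D.support, p.1.card ≤ r) ∧
      ∀ c ∈ C, ∀ y : I → F,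
        (hammingDist y c : ℝ) ≤ δ * (Fintype.card I) →
          ENNReal.ofReal (1 - ε) ≤
            D.toOuterMeasure {p | p.2 (fun t => y t.1) = fun s => c s.1}

/-- The Reed-Muller code `RM(q,d,m)`: evaluation vectors over `F^m` of `m`-variate
polynomials of total degree at most `d`. -/
def ReedMullerCode (F : Type*) [CommSemiring F] (d m : ℕ) : Set ((Fin m → F) → F) :=
  {w | ∃ f : MvPolynomial (Fin m) F, f.totalDegree ≤ d ∧ ∀ u, MvPolynomial.eval u f = w u}

open Finset

/-- The point with parameter `t` on the parametrised conic through `u` with coefficients `v`. -/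
def conicPoint {F V : Type*} [Field F] [AddCommGroup V] [Module F V] (u : V) (v : V × V) (t : F) :
    V :=
  u + t • v.1 + t ^ 2 • v.2

section Conic

variable {F V : Type*} [Field F] [AddCommGroup V] [Module F V]

theorem conicPoint_pair_injective (u : V) {s t : F} (hs : s ≠ 0) (ht : t ≠ 0) (hst : s ≠ t) :
    Function.Injective fun v : V × V => (conicPoint u v s, conicPoint u v t) := by
  rintro ⟨v, w⟩ ⟨v', w'⟩ h
  simp only [conicPoint, Prod.mk.injEq] at h
  obtain ⟨h₁, h₂⟩ := h
  have e₁ : s • ((v - v') + s • (w - w')) = 0 := by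
    linear_combination (norm := module) h₁
  have e₂ : t • ((v - v') + t • (w - w')) = 0 := by
    linear_combination (norm := module) h₂
  have e₁' := (smul_eq_zero.mp e₁).resolve_left hs
  have e₂' := (smul_eq_zero.mp e₂).resolve_left ht
  have e₃ : (s - t) • (w - w') = 0 := by
    linear_combination (norm := module) e₁' - e₂'
  have hw := (smul_eq_zero.mp e₃).resolve_left (sub_ne_zero.mpr hst)
  rw [hw, smul_zero, add_zero] at e₁'
  exact Prod.ext (sub_eq_zero.mp e₁') (sub_eq_zero.mp hw)

theorem conicPoint_snd_injective (u : V) {s : F} (hs : s ≠ 0) :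
    Function.Injective fun v : V × V => (conicPoint u v s, v.2) := by
  rintro ⟨v, w⟩ ⟨v', w'⟩ h
  simp only [conicPoint, Prod.mk.injEq] at h
  obtain ⟨h₁, rfl⟩ := h
  have : s • v = s • v' := by simpa using h₁
  rw [smul_right_injective V hs this]

variable [Fintype V]

/-- On a random conic through `u`, the values of a centred function at distinct nonzero parameters
are uncorrelated. -/
theorem sum_sq_sum_conicPoint (u : V) (A : Finset F) (hA : ∀ t ∈ A, t ≠ 0) (h : V → ℝ)
    (hh : ∑ x, h x = 0) :
    ∑ v : V × V, (∑ t ∈ A, h (conicPoint u v t)) ^ 2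
      = #A * (Fintype.card V * ∑ x, h x ^ 2) := by
  classical
  have hpair : ∀ s ∈ A, ∀ t ∈ A,
      ∑ v : V × V, h (conicPoint u v s) * h (conicPoint u v t)
        = if s = t then Fintype.card V * ∑ x, h x ^ 2 else 0 := by
    intro s hs t ht
    split_ifs with hst
    · subst hst
      have hb := Finite.injective_iff_bijective.mp (conicPoint_snd_injective u (hA s hs))
      calc _ = ∑ z : V × V, h z.1 ^ 2 :=
            hb.sum_comp (fun z : V × V => h z.1 ^ 2) ▸ sum_congr rfl fun v _ => (sq _).symm
        _ = _ := by
            rw [Fintype.sum_prod_type_right]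
            simp
    · have hb := Finite.injective_iff_bijective.mp
        (conicPoint_pair_injective u (hA s hs) (hA t ht) hst)
      rw [hb.sum_comp (fun z : V × V => h z.1 * h z.2), Fintype.sum_prod_type]
      simp [← mul_sum, hh]
  simp_rw [sq (∑ t ∈ A, _), sum_mul_sum]
  rw [sum_comm]
  simp_rw [sum_comm (s := univ) (t := A)]
  rw [sum_congr rfl fun s hs => sum_congr rfl fun t ht => hpair s hs t ht]
  simp

/-- Chebyshev's inequality for the number of points of `B` on a random conic through `u`. -/
theorem card_conic_filter_mul_sq_le (u : V) (A : Finset F) (hA : ∀ t ∈ A, t ≠ 0)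
    (B : Finset V) [DecidableEq V] {b τ : ℝ} (hb : (#B : ℝ) = b * Fintype.card V) (hτ : b ≤ τ) :
    (#{v : V × V | τ * #A ≤ #{t ∈ A | conicPoint u v t ∈ B}} : ℝ) * ((τ - b) * #A) ^ 2
      ≤ #A * Fintype.card V ^ 2 * (b - b ^ 2) := by
  let h : V → ℝ := fun x => (if x ∈ B then 1 else 0) - b
  have hh : ∑ x, h x = 0 := by
    simp [h, hb, mul_comm]
  have hsq : ∑ x, h x ^ 2 = Fintype.card V * (b - b ^ 2) := by
    have : ∀ x, h x ^ 2 = (1 - 2 * b) * (if x ∈ B then 1 else 0) + b ^ 2 := by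
      intro x
      simp only [h]
      split_ifs <;> ring
    simp_rw [this, sum_add_distrib, ← mul_sum]
    simp [hb]
    ring
  have key := sum_sq_sum_conicPoint u A hA h hh
  rw [hsq] at key
  have hsum : ∀ v : V × V, ∑ t ∈ A, h (conicPoint u v t)
      = #{t ∈ A | conicPoint u v t ∈ B} - b * #A := by
    intro v
    simp [h, mul_comm]
  calc _ = ∑ v ∈ {v : V × V | τ * #A ≤ #{t ∈ A | conicPoint u v t ∈ B}},
        ((τ - b) * #A) ^ 2 := by rw [sum_const, nsmul_eq_mul]
    _ ≤ ∑ v ∈ {v : V × V | τ * #A ≤ #{t ∈ A | conicPoint u v t ∈ B}},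
        (∑ t ∈ A, h (conicPoint u v t)) ^ 2 := by
      refine sum_le_sum fun v hv => ?_
      rw [hsum]
      have := (mem_filter.mp hv).2
      have h0 : 0 ≤ (τ - b) * #A := mul_nonneg (sub_nonneg.mpr hτ) (Nat.cast_nonneg _)
      gcongr
      linarith
    _ ≤ ∑ v : V × V, (∑ t ∈ A, h (conicPoint u v t)) ^ 2 :=
      sum_le_sum_of_subset_of_nonneg (subset_univ _) fun _ _ _ => sq_nonneg _
    _ = _ := by rw [key]; ring

end Conic

section Decoding

variable {F : Type*} [Field F] [DecidableEq F]

open Classical in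
/-- Unique decoding at `0` of a word on `A` to a polynomial of degree at most `e`. -/
noncomputable def reedSolomonDecode (A : Finset F) (e : ℕ) (z : F → F) : F :=
  if h : ∃ p : Polynomial F, p.natDegree ≤ e ∧ 2 * #{t ∈ A | z t ≠ p.eval t} + e < #A then
    h.choose.eval 0
  else 0

theorem reedSolomonDecode_eq (A : Finset F) {e : ℕ} {z : F → F} {p : Polynomial F}
    (hp : p.natDegree ≤ e) (hz : 2 * #{t ∈ A | z t ≠ p.eval t} + e < #A) :
    reedSolomonDecode A e z = p.eval 0 := by
  have hex : ∃ p : Polynomial F, p.natDegree ≤ e ∧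
    2 * #{t ∈ A | z t ≠ p.eval t} + e < #A := ⟨p, hp, hz⟩
  rw [reedSolomonDecode, dif_pos hex]
  obtain ⟨h₁, h₂⟩ := hex.choose_spec
  generalize hex.choose = r at h₁ h₂ ⊢
  congr 1
  have hsub : A ⊆ ({t ∈ A | z t ≠ p.eval t} ∪ {t ∈ A | z t ≠ r.eval t})
      ∪ {t ∈ A | r.eval t = p.eval t} := by
    intro t ht
    simp only [mem_union, mem_filter, ht, true_and]
    by_cases h₃ : z t = p.eval t <;> by_cases h₄ : z t = r.eval t <;> simp_all
  have hcard := (card_le_card hsub).trans (card_union_le _ _)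
  have hcard' := card_union_le {t ∈ A | z t ≠ p.eval t} {t ∈ A | z t ≠ r.eval t}
  have hlt : max r.natDegree p.natDegree < #{t ∈ A | r.eval t = p.eval t} := by
    have := max_le h₁ hp
    omega
  exact Polynomial.eq_of_natDegree_lt_card_of_eval_eq' r p _
    (fun t ht => (mem_filter.mp ht).2) hlt

end Decoding

theorem MvPolynomial.exists_polynomial_eval_conicPoint {F ι : Type*} [Field F]
    (f : MvPolynomial ι F) (u : ι → F) (v : (ι → F) × (ι → F)) :
    ∃ p : Polynomial F, p.natDegree ≤ 2 * f.totalDegree ∧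
      ∀ t, p.eval t = MvPolynomial.eval (conicPoint u v t) f := by
  let g : ι → Polynomial F := fun i =>
    .C (u i) + .C (v.1 i) * .X + .C (v.2 i) * .X ^ 2
  refine ⟨MvPolynomial.aeval g f, ?_, fun t => ?_⟩
  · rw [mul_comm]
    refine MvPolynomial.aeval_natDegree_le f le_rfl g fun i => ?_
    simp only [g]
    compute_degree
  · rw [← Polynomial.coe_evalRingHom, MvPolynomial.aeval_def, MvPolynomial.hom_eval₂,
      MvPolynomial.eval, MvPolynomial.coe_eval₂Hom]
    congr 1
    · ext; simp
    · ext i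
      simp [g, conicPoint]
      ring

/-- Chebyshev's inequality for the proportion of conics through `u` meeting `B` rarely. -/
theorem ofReal_le_card_conic_filter_div {F V : Type*} [Field F] [AddCommGroup V] [Module F V]
    [Fintype V] [DecidableEq V] (u : V) (A : Finset F) (hA : ∀ t ∈ A, t ≠ 0) (hA₀ : A.Nonempty)
    (B : Finset V) {δ τ : ℝ} (hB : (#B : ℝ) ≤ δ * Fintype.card V) (hδ : δ ≤ 1 / 2) (hτ : δ < τ) :
    ENNReal.ofReal (1 - (δ - δ ^ 2) / ((τ - δ) ^ 2 * #A)) ≤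
      #{v : V × V | #{t ∈ A | conicPoint u v t ∈ B} < τ * #A} / Fintype.card (V × V) := by
  have hV : (0 : ℝ) < Fintype.card V := by exact_mod_cast Fintype.card_pos
  have hn : (0 : ℝ) < #A := by exact_mod_cast hA₀.card_pos
  obtain ⟨b, hb⟩ : ∃ b : ℝ, (#B : ℝ) = b * Fintype.card V := ⟨#B / Fintype.card V, by field_simp⟩
  have hbδ : b ≤ δ := le_of_mul_le_mul_right (hb ▸ hB) hV
  have key := card_conic_filter_mul_sq_le u A hA B hb (hbδ.trans hτ.le)
  have hsplit := card_filter_add_card_filter_not (s := (univ : Finset (V × V)))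
    (fun v => (#{t ∈ A | conicPoint u v t ∈ B} : ℝ) < τ * #A)
  simp only [not_lt, card_univ, Fintype.card_prod] at hsplit
  set good := #{v : V × V | (#{t ∈ A | conicPoint u v t ∈ B} : ℝ) < τ * #A}
  set bad := #{v : V × V | τ * #A ≤ (#{t ∈ A | conicPoint u v t ∈ B} : ℝ)}
  have hsplit' : (good : ℝ) + bad = Fintype.card V ^ 2 := by
    rw [sq]
    exact_mod_cast hsplit
  have hbad : (bad : ℝ) ≤ Fintype.card V ^ 2 * ((δ - δ ^ 2) / ((τ - δ) ^ 2 * #A)) := by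
    have hpos : 0 < τ - δ := sub_pos.mpr hτ
    rw [mul_div_assoc', le_div_iff₀ (by positivity)]
    refine le_of_mul_le_mul_right ?_ hn
    calc bad * ((τ - δ) ^ 2 * #A) * #A = bad * ((τ - δ) * #A) ^ 2 := by ring
      _ ≤ bad * ((τ - b) * #A) ^ 2 := by gcongr
      _ ≤ #A * Fintype.card V ^ 2 * (b - b ^ 2) := key
      _ ≤ #A * Fintype.card V ^ 2 * (δ - δ ^ 2) := by
        gcongr ?_ * ?_
        nlinarith
      _ = _ := by ring
  refine ENNReal.ofReal_le_of_le_toReal ?_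
  simp only [ENNReal.toReal_div, ENNReal.toReal_natCast, Fintype.card_prod]
  rw [Nat.cast_mul, ← sq, le_div_iff₀ (by positivity)]
  linarith

theorem two_mul_card_add_lt {n k d : ℕ} {σ : ℝ} (hd : (d : ℝ) ≤ σ * n - 1)
    (hk : (k : ℝ) < (1 - 2 * σ) / 2 * n) : 2 * k + 2 * d < n := by
  have : (2 * k + 2 * d : ℝ) < n := by linarith
  exact_mod_cast this

theorem stmt_2 (q : ℕ) (F : Type) [Field F] [Fintype F] [DecidableEq F]
    (hF : Fintype.card F = q) (m : ℕ) (hm : 0 < m)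
    (σ δ : ℝ) (hσ : σ ∈ Set.Ioo (0 : ℝ) 1) (hδ : δ ∈ Set.Ioo (0 : ℝ) 1)
    (hδσ : δ < (1 - 2 * σ) / 2)
    (d : ℕ) (hd : 0 < d) (hdσ : (d : ℝ) ≤ σ * ((q : ℝ) - 1) - 1) :
    LocallyCorrectable (ReedMullerCode F d m) 1 (q - 1) δ
      (4 * (δ - δ ^ 2) / ((1 - 2 * σ - 2 * δ) ^ 2 * ((q : ℝ) - 1))) := by
  obtain ⟨hσ₀, -⟩ := hσ
  obtain ⟨hδ₀, hδ₁⟩ := hδ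
  have hq : 1 < q := hF ▸ Fintype.one_lt_card
  intro S hS
  obtain ⟨u, hu⟩ := card_le_one_iff_subset_singleton.mp hS
  let A : Finset F := univ.erase 0
  have hA : ∀ t ∈ A, t ≠ 0 := fun t ht => ne_of_mem_erase ht
  have hAcard : #A = q - 1 := by simp [A, hF]
  have hAcard' : (#A : ℝ) = q - 1 := by rw [hAcard, Nat.cast_sub hq.le, Nat.cast_one]
  let V := Fin m → F
  let query : V × V → (T : Finset V) × ((↥T → F) → (↥S → F)) := fun v =>
    ⟨A.image (conicPoint u v), fun z _ =>
      reedSolomonDecode A (2 * d) fun t =>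
        if h : conicPoint u v t ∈ A.image (conicPoint u v) then z ⟨_, h⟩ else 0⟩
  refine ⟨(PMF.uniformOfFintype (V × V)).map query, ?_, ?_⟩
  · intro p hp
    obtain ⟨v, -, rfl⟩ := (PMF.mem_support_map_iff _ _ _).mp hp
    exact card_image_le.trans hAcard.le
  · rintro c ⟨f, hf, hfc⟩ y hy
    let B : Finset V := {x | y x ≠ c x}
    have hcheb := ofReal_le_card_conic_filter_div (τ := (1 - 2 * σ) / 2) u A hA
      (card_pos.mp (by omega)) B hy (by linarith) hδσ
    have hεeq : 4 * (δ - δ ^ 2) / ((1 - 2 * σ - 2 * δ) ^ 2 * ((q : ℝ) - 1))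
        = (δ - δ ^ 2) / (((1 - 2 * σ) / 2 - δ) ^ 2 * #A) := by
      rw [hAcard', show ((1 - 2 * σ) / 2 - δ) ^ 2 = (1 - 2 * σ - 2 * δ) ^ 2 / 4 by ring]
      field_simp
    rw [hεeq]
    refine hcheb.trans ?_
    classical
    rw [PMF.toOuterMeasure_map_apply, PMF.toOuterMeasure_uniformOfFintype_apply,
      Fintype.card_subtype]
    gcongr with v
    intro hv
    funext s
    obtain ⟨p, hpdeg, hp⟩ := f.exists_polynomial_eval_conicPoint u v
    have hcp : ∀ t, c (conicPoint u v t) = p.eval t := fun t => by rw [hp, hfc]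
    have hlt := two_mul_card_add_lt (hAcard' ▸ hdσ) hv
    have hs : s.1 = u := mem_singleton.mp (hu s.2)
    have h₀ : c s.1 = p.eval 0 := by
      rw [← hcp, hs]
      simp [conicPoint]
    rw [h₀]
    refine reedSolomonDecode_eq A (hpdeg.trans (by omega)) ?_
    convert hlt using 4
    refine filter_congr fun t ht => ?_
    rw [dif_pos (mem_image_of_mem _ ht), ← hcp]
    simp [B]
end

section
/- Let q be a prime power, m ≥ 1 an integer, and σ, δ ∈ (0,1) reals with δ < (1−σ)/2. Let k, n, d be positive integers with d > 1, k + n ≤ q, and d < σn/(k+2). Then the Reed-Muller code RM(q,d,m) is a (k; n, δ, ε)-locally correctable code, where ε = 4(δ−δ²)/((1−σ−2δ)² n). -/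
open scoped BigOperators

open Polynomial in
/-- Two polynomials of degree at most `D` that are both close to the same word agree. -/
theorem Polynomial.eq_of_hammingDist_eval_lt {F ι : Type*} [Field F] [DecidableEq F] [Fintype ι]
    {w : ι → F} (hw : Function.Injective w) {D : ℕ} {h : ι → F} {P Q : F[X]}
    (hP : P.natDegree ≤ D) (hQ : Q.natDegree ≤ D)
    (hPh : 2 * hammingDist (fun j => P.eval (w j)) h + D < Fintype.card ι)
    (hQh : 2 * hammingDist (fun j => Q.eval (w j)) h + D < Fintype.card ι) : P = Q := by
  classical
  have htri := hammingDist_triangle_right (fun j => P.eval (w j)) (fun j => Q.eval (w j)) h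
  set A : Finset ι := Finset.univ.filter fun j => P.eval (w j) = Q.eval (w j)
  have hcard : A.card + hammingDist (fun j => P.eval (w j)) (fun j => Q.eval (w j))
      = Fintype.card ι :=
    Finset.card_filter_add_card_filter_not (s := Finset.univ)
      (fun j => P.eval (w j) = Q.eval (w j))
  refine Polynomial.eq_of_natDegree_lt_card_of_eval_eq' P Q (A.image w) ?_ ?_
  · intro x hx
    obtain ⟨j, hj, rfl⟩ := Finset.mem_image.1 hx
    exact (Finset.mem_filter.1 hj).2
  · rw [Finset.card_image_of_injective _ hw]
    have := max_le hP hQ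
    omega

open Polynomial Classical in
/-- Unique decoding of a word received at the nodes `w` to a polynomial of degree at most `D`. -/
noncomputable def uniqueDecode {F ι : Type*} [Field F] [DecidableEq F] [Fintype ι]
    (D : ℕ) (w h : ι → F) : F[X] :=
  if hP : ∃ P : F[X], P.natDegree ≤ D ∧
      2 * hammingDist (fun j => P.eval (w j)) h + D < Fintype.card ι
  then hP.choose else 0

open Polynomial in
theorem uniqueDecode_eq {F ι : Type*} [Field F] [DecidableEq F] [Fintype ι]
    {w : ι → F} (hw : Function.Injective w) {D : ℕ} {h : ι → F} {P : F[X]}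
    (hP : P.natDegree ≤ D)
    (hPh : 2 * hammingDist (fun j => P.eval (w j)) h + D < Fintype.card ι) :
    uniqueDecode D w h = P := by
  have hex : ∃ P : F[X], P.natDegree ≤ D ∧
      2 * hammingDist (fun j => P.eval (w j)) h + D < Fintype.card ι := ⟨P, hP, hPh⟩
  rw [uniqueDecode, dif_pos hex]
  exact Polynomial.eq_of_hammingDist_eval_lt hw hex.choose_spec.1 hP hex.choose_spec.2 hPh

/-- The second moment of a sum of pairwise independent uniform samples of a centred function. -/
theorem sum_sq_sum_of_pairwise_bijective {Ω V ι : Type*} [Fintype Ω] [Fintype V] [Fintype ι]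
    {p : ι → Ω → V}
    (hpair : ∀ i j, i ≠ j → Function.Bijective fun ω => (p i ω, p j ω))
    (hunif : ∀ i (ψ : V → ℝ), ∑ ω, ψ (p i ω) = Fintype.card V * ∑ v, ψ v)
    {φ : V → ℝ} (hφ : ∑ v, φ v = 0) :
    ∑ ω, (∑ i, φ (p i ω)) ^ 2 = Fintype.card ι * (Fintype.card V * ∑ v, φ v ^ 2) := by
  classical
  have hoff : ∀ i j, i ≠ j → ∑ ω, φ (p i ω) * φ (p j ω) = 0 := by
    intro i j hij
    rw [(hpair i j hij).sum_comp (fun x : V × V => φ x.1 * φ x.2), Fintype.sum_prod_type,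
      ← Finset.sum_mul_sum, hφ, zero_mul]
  calc ∑ ω, (∑ i, φ (p i ω)) ^ 2
      = ∑ i, ∑ j, ∑ ω, φ (p i ω) * φ (p j ω) := by
        simp_rw [sq, Finset.sum_mul_sum]
        rw [Finset.sum_comm]
        exact Finset.sum_congr rfl fun i _ => Finset.sum_comm
    _ = ∑ i : ι, ∑ ω, φ (p i ω) ^ 2 := by
        refine Finset.sum_congr rfl fun i _ => ?_
        rw [Finset.sum_eq_single i (fun j _ hj => hoff i j hj.symm) (by simp)]
        simp_rw [sq]
    _ = _ := by
        simp [hunif _ fun v => φ v ^ 2]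

/-- Chebyshev's inequality for the number of pairwise independent uniform samples in a set `B`
of density at most `δ`. -/
theorem card_many_samples_mem_le {Ω V ι : Type*} [Fintype Ω] [Fintype V] [Nonempty V]
    [Fintype ι] [Nonempty ι] [DecidableEq V] {p : ι → Ω → V}
    (hpair : ∀ i j, i ≠ j → Function.Bijective fun ω => (p i ω, p j ω))
    (hunif : ∀ i (ψ : V → ℝ), ∑ ω, ψ (p i ω) = Fintype.card V * ∑ v, ψ v)
    (B : Finset V) {σ δ : ℝ} (hσ : 0 < σ) (hδσ : δ < (1 - σ) / 2)
    (hB : (B.card : ℝ) ≤ δ * Fintype.card V) :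
    ((Finset.univ.filter fun ω => (1 - σ) / 2 * Fintype.card ι ≤
        ((Finset.univ.filter fun i => p i ω ∈ B).card : ℝ)).card : ℝ) ≤
      4 * (δ - δ ^ 2) / ((1 - σ - 2 * δ) ^ 2 * Fintype.card ι) * (Fintype.card V) ^ 2 := by
  set M := (Fintype.card V : ℝ) with hM
  set n := (Fintype.card ι : ℝ) with hn
  have hMpos : 0 < M := by rw [hM]; exact_mod_cast Fintype.card_pos
  have hnpos : 0 < n := by rw [hn]; exact_mod_cast Fintype.card_pos
  set e : ℝ := B.card / M with he
  have heM : (B.card : ℝ) = e * M := by rw [he]; field_simp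
  have he0 : 0 ≤ e := div_nonneg (Nat.cast_nonneg _) hMpos.le
  have heδ : e ≤ δ := by rw [he, div_le_iff₀ hMpos]; exact hB
  have hind : ∑ v, (if v ∈ B then (1 : ℝ) else 0) = e * M := by
    rw [← heM, Finset.sum_boole, Finset.filter_univ_mem]
  have hconst (x : ℝ) : ∑ _v : V, x = M * x := by
    rw [Finset.sum_const, Finset.card_univ, nsmul_eq_mul]
  set φ : V → ℝ := fun v => (if v ∈ B then 1 else 0) - e with hφdef
  have hφ : ∑ v, φ v = 0 := by
    rw [hφdef, Finset.sum_sub_distrib, hind, hconst, mul_comm, sub_self]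
  have hφ2 : ∑ v, φ v ^ 2 = M * (e - e ^ 2) := by
    have : ∀ v, φ v ^ 2 = (1 - 2 * e) * (if v ∈ B then 1 else 0) + e ^ 2 := by
      intro v; simp only [hφdef]; split_ifs <;> ring
    simp_rw [this, Finset.sum_add_distrib, ← Finset.mul_sum]
    rw [hind, hconst]; ring
  have hsq := sum_sq_sum_of_pairwise_bijective hpair hunif hφ
  rw [hφ2, ← hM, ← hn] at hsq
  have hsum : ∀ ω, ∑ i, φ (p i ω) =
      ((Finset.univ.filter fun i => p i ω ∈ B).card : ℝ) - e * n := by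
    intro ω
    simp [hφdef, Finset.sum_sub_distrib, ← hn]; ring
  set bad := Finset.univ.filter fun ω => (1 - σ) / 2 * n ≤
        ((Finset.univ.filter fun i => p i ω ∈ B).card : ℝ)
  have hgap : 0 < (1 - σ) / 2 - δ := by linarith
  have hmarkov : (bad.card : ℝ) * (((1 - σ) / 2 - δ) * n) ^ 2 ≤ n * (M * (M * (e - e ^ 2))) := by
    rw [← hsq, ← nsmul_eq_mul]
    refine (Finset.card_nsmul_le_sum bad _ _ fun ω hω => ?_).trans
      (Finset.sum_le_sum_of_subset_of_nonneg (Finset.subset_univ _) fun _ _ _ => sq_nonneg _)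
    have h1 := (Finset.mem_filter.1 hω).2
    rw [hsum]
    refine pow_le_pow_left₀ (by positivity) ?_ 2
    have := mul_le_mul_of_nonneg_right heδ hnpos.le
    linarith
  have hvar : e - e ^ 2 ≤ δ - δ ^ 2 := by nlinarith
  have hmain : (bad.card : ℝ) * (((1 - σ) / 2 - δ) * n) ^ 2 ≤ n * (M * (M * (δ - δ ^ 2))) :=
    hmarkov.trans (by gcongr)
  have h2 : (1 - σ - 2 * δ) = 2 * ((1 - σ) / 2 - δ) := by ring
  rw [h2, div_mul_eq_mul_div, le_div_iff₀ (by positivity)]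
  refine le_of_mul_le_mul_left ?_ hnpos
  linarith

open Polynomial in
/-- The curve `t ↦ L t + Z t • (a + t • b)`, where `L` interpolates the points of `S` at the
nodes `z` and `Z` vanishes exactly at the nodes. -/
noncomputable def interpolatingCurve {F : Type*} [Field F] {m : ℕ} {S : Finset (Fin m → F)}
    (z : S → F) (a b : Fin m → F) (i : Fin m) : F[X] :=
  open Classical in
  Lagrange.interpolate Finset.univ z (fun s => s.1 i) +
    Lagrange.nodal Finset.univ z * (C (a i) + C (b i) * X)

section InterpolatingCurve

variable {F : Type*} [Field F] {m : ℕ} {S : Finset (Fin m → F)} {z : S → F}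

theorem natDegree_interpolatingCurve_le (hz : Function.Injective z) (a b : Fin m → F)
    (i : Fin m) : (interpolatingCurve z a b i).natDegree ≤ S.card + 1 := by
  classical
  refine (Polynomial.natDegree_add_le _ _).trans (max_le ?_ ?_)
  · refine (Polynomial.natDegree_le_of_degree_le
      (Lagrange.degree_interpolate_lt _ hz.injOn).le).trans ?_
    simp
  · refine Polynomial.natDegree_mul_le.trans ?_
    rw [Lagrange.natDegree_nodal]
    have : (Polynomial.C (a i) + Polynomial.C (b i) * Polynomial.X).natDegree ≤ 1 := by
      rw [add_comm]; exact Polynomial.natDegree_linear_le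
    simpa using this

theorem eval_interpolatingCurve_node (hz : Function.Injective z) (a b : Fin m → F)
    (s : S) : (fun i => (interpolatingCurve z a b i).eval (z s)) = s.1 := by
  classical
  funext i
  rw [interpolatingCurve, Polynomial.eval_add, Polynomial.eval_mul,
    Lagrange.eval_interpolate_at_node _ hz.injOn (Finset.mem_univ s),
    Lagrange.eval_nodal_at_node (Finset.mem_univ s), zero_mul, add_zero]

theorem eval_interpolatingCurve_eq_iff {t : F} (ht : ∀ s, t ≠ z s)
    (a b a' b' : Fin m → F) :
    (fun i => (interpolatingCurve z a b i).eval t) =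
      (fun i => (interpolatingCurve z a' b' i).eval t) ↔ a + t • b = a' + t • b' := by
  have hne : (Lagrange.nodal Finset.univ z).eval t ≠ 0 :=
    Lagrange.eval_nodal_not_at_node fun s _ => ht s
  simp only [funext_iff]
  refine forall_congr' fun i => ?_
  rw [interpolatingCurve, interpolatingCurve, Polynomial.eval_add, Polynomial.eval_add,
    Polynomial.eval_mul, Polynomial.eval_mul, add_right_inj, mul_right_inj' hne]
  simp [mul_comm t]

theorem bijective_eval_interpolatingCurve_pair [Finite F] {t u : F} (ht : ∀ s, t ≠ z s)
    (hu : ∀ s, u ≠ z s) (htu : t ≠ u) :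
    Function.Bijective fun ω : (Fin m → F) × (Fin m → F) =>
      ((fun i => (interpolatingCurve z ω.1 ω.2 i).eval t),
        (fun i => (interpolatingCurve z ω.1 ω.2 i).eval u)) := by
  refine Finite.injective_iff_bijective.1 ?_
  rintro ⟨a, b⟩ ⟨a', b'⟩ h
  obtain ⟨h1, h2⟩ := Prod.mk.inj h
  have h1 := (eval_interpolatingCurve_eq_iff ht _ _ _ _).1 h1
  have h2 := (eval_interpolatingCurve_eq_iff hu _ _ _ _).1 h2
  have hb : b = b' := by
    funext i
    have e1 := congrFun h1 i
    have e2 := congrFun h2 i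
    simp only [Pi.add_apply, Pi.smul_apply, smul_eq_mul] at e1 e2
    exact mul_left_cancel₀ (sub_ne_zero.2 htu) (by linear_combination e1 - e2)
  subst hb
  simpa using h1

theorem sum_eval_interpolatingCurve [Fintype F] {t : F} (ht : ∀ s, t ≠ z s)
    (ψ : (Fin m → F) → ℝ) :
    ∑ ω : (Fin m → F) × (Fin m → F), ψ (fun i => (interpolatingCurve z ω.1 ω.2 i).eval t) =
      Fintype.card (Fin m → F) * ∑ v, ψ v := by
  have hbij (b : Fin m → F) :
      Function.Bijective fun a : Fin m → F => fun i => (interpolatingCurve z a b i).eval t := by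
    refine Finite.injective_iff_bijective.1 fun a a' h => ?_
    simpa using (eval_interpolatingCurve_eq_iff ht _ _ _ _).1 h
  rw [Fintype.sum_prod_type_right]
  simp_rw [fun b => (hbij b).sum_comp ψ]
  simp

end InterpolatingCurve

theorem Polynomial.eval_mvPolynomial_aeval {R τ : Type*} [CommSemiring R]
    (γ : τ → Polynomial R) (f : MvPolynomial τ R) (t : R) :
    (MvPolynomial.aeval γ f).eval t = MvPolynomial.eval (fun i => (γ i).eval t) f := by
  induction f using MvPolynomial.induction_on with
  | C a => simp
  | add p q hp hq => simp [hp, hq]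
  | mul_X p i hp => simp [hp]

/-- An event holding for all but an `ε` fraction of the sample points has probability at least
`1 - ε` under the image of the uniform distribution. -/
theorem PMF.ofReal_le_toOuterMeasure_map_uniformOfFintype {Ω β : Type*} [Fintype Ω] [Nonempty Ω]
    (G : Ω → β) (A : Set β) (bad : Finset Ω) {ε : ℝ}
    (hbad : (bad.card : ℝ) ≤ ε * Fintype.card Ω) (hA : ∀ ω ∉ bad, G ω ∈ A) :
    ENNReal.ofReal (1 - ε) ≤ ((PMF.uniformOfFintype Ω).map G).toOuterMeasure A := by
  classical
  have hpos : (0 : ℝ) < Fintype.card Ω := by exact_mod_cast Fintype.card_pos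
  rw [PMF.toOuterMeasure_map_apply]
  refine le_trans ?_ ((PMF.uniformOfFintype Ω).toOuterMeasure.mono
    (show ((badᶜ : Finset Ω) : Set Ω) ⊆ G ⁻¹' A from fun ω hω => hA ω (by simpa using hω)))
  change _ ≤ (PMF.uniformOfFintype Ω).toOuterMeasure _
  rw [PMF.toOuterMeasure_uniformOfFintype_apply]
  have hc : (bad.card : ℝ) + ((badᶜ : Finset Ω).card : ℝ) = Fintype.card Ω := by
    exact_mod_cast Finset.card_add_card_compl bad
  refine (ENNReal.ofReal_le_ofReal
    (show 1 - ε ≤ ((badᶜ : Finset Ω).card : ℝ) / Fintype.card Ω from ?_)).trans ?_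
  · rw [le_div_iff₀ hpos]; linarith
  · rw [ENNReal.ofReal_div_of_pos hpos, ENNReal.ofReal_natCast, ENNReal.ofReal_natCast]
    simp [Fintype.card_subtype, ← Finset.filter_notMem_eq_sdiff,
      Finset.compl_eq_univ_sdiff]


theorem stmt_16 (q : ℕ) (F : Type) [Field F] [Fintype F] [DecidableEq F]
    (hF : Fintype.card F = q) (m : ℕ) (hm : 1 ≤ m)
    (σ δ : ℝ) (hσ : σ ∈ Set.Ioo (0 : ℝ) 1) (hδ : δ ∈ Set.Ioo (0 : ℝ) 1)
    (hδσ : δ < (1 - σ) / 2)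
    (k n d : ℕ) (hk : 0 < k) (hn : 0 < n) (hd : 1 < d)
    (hkn : k + n ≤ q) (hdσ : (d : ℝ) < σ * n / (k + 2)) :
    LocallyCorrectable (ReedMullerCode F d m) k n δ
      (4 * (δ - δ ^ 2) / ((1 - σ - 2 * δ) ^ 2 * (n : ℝ))) := by
  classical
  subst hF
  intro S hS
  obtain ⟨emb⟩ : Nonempty (S ⊕ Fin n ↪ F) :=
    Function.Embedding.nonempty_of_card_le (by simp; omega)
  set z : S → F := fun s => emb (Sum.inl s)
  set w : Fin n → F := fun j => emb (Sum.inr j)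
  have hz : Function.Injective z := emb.injective.comp Sum.inl_injective
  have hw : Function.Injective w := emb.injective.comp Sum.inr_injective
  have hwz : ∀ j s, w j ≠ z s := fun j s h => by simpa using emb.injective h
  let Ω := (Fin m → F) × (Fin m → F)
  let p : Fin n → Ω → (Fin m → F) := fun j ω i => (interpolatingCurve z ω.1 ω.2 i).eval (w j)
  let G : Ω → ((T : Finset (Fin m → F)) × ((↥T → F) → (↥S → F))) := fun ω =>
    ⟨Finset.univ.image fun j => p j ω, fun v s =>
      (uniqueDecode (d * (k + 1)) w fun j =>
        v ⟨p j ω, Finset.mem_image_of_mem _ (Finset.mem_univ j)⟩).eval (z s)⟩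
  refine ⟨(PMF.uniformOfFintype Ω).map G, ?_, ?_⟩
  · intro x hx
    obtain ⟨ω, -, rfl⟩ := (PMF.mem_support_map_iff _ _ _).1 hx
    exact Finset.card_image_le.trans (by simp)
  · rintro c ⟨f, hf, hfc⟩ y hy
    have : Nonempty (Fin n) := ⟨⟨0, hn⟩⟩
    set B : Finset (Fin m → F) := Finset.univ.filter fun u => y u ≠ c u with hB
    have hcheb := card_many_samples_mem_le (p := p)
      (fun i j hij => bijective_eval_interpolatingCurve_pair (hwz i) (hwz j) (hw.ne hij))
      (fun i ψ => sum_eval_interpolatingCurve (hwz i) ψ) B hσ.1 hδσ hy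
    rw [Fintype.card_fin] at hcheb
    refine PMF.ofReal_le_toOuterMeasure_map_uniformOfFintype G _ _
      (hcheb.trans_eq (by simp only [Ω, Fintype.card_prod]; push_cast; ring)) fun ω hω => ?_
    set P := MvPolynomial.aeval (interpolatingCurve z ω.1 ω.2) f with hP
    have hdeg : P.natDegree ≤ d * (k + 1) :=
      MvPolynomial.aeval_natDegree_le f hf _ fun i =>
        (natDegree_interpolatingCurve_le hz _ _ i).trans (by omega)
    have hPw : ∀ j, P.eval (w j) = c (p j ω) := fun j => by
      rw [hP, Polynomial.eval_mvPolynomial_aeval, hfc]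
    have hPz : ∀ s : S, P.eval (z s) = c s.1 := fun s => by
      rw [hP, Polynomial.eval_mvPolynomial_aeval, eval_interpolatingCurve_node hz, hfc]
    have hdist : hammingDist (fun j => P.eval (w j)) (fun j => y (p j ω)) =
        (Finset.univ.filter fun j => p j ω ∈ B).card := by
      simp only [hammingDist, hPw, hB, Finset.mem_filter, Finset.mem_univ, true_and, ne_comm]
    have hfew : 2 * hammingDist (fun j => P.eval (w j)) (fun j => y (p j ω)) + d * (k + 1) <
        Fintype.card (Fin n) := by
      rw [hdist, Fintype.card_fin]
      simp only [Finset.mem_filter, Finset.mem_univ, true_and, not_le] at hω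
      rw [lt_div_iff₀ (by positivity)] at hdσ
      have hd0 : (0 : ℝ) ≤ d := by positivity
      rw [← Nat.cast_lt (α := ℝ)]
      push_cast
      linarith
    funext s
    simp only [G]
    rw [uniqueDecode_eq hw hdeg hfew, hPz]
end
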